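/- For every integer n ≥ 1, the coefficient of y^0 in the formal Laurent series D · (S_y^n A) is equal to zero, where D := Σ_{m≥0} d_m u^{−2m} y^{3m}. -/

import Mathlib

noncomputable section

/-- The base field `K = ℂ(u)`, rational functions in the variable `u`. -/
abbrev K : Type := RatFunc ℂ

/-- The variable `u ∈ K`. -/
def u : K := RatFunc.X

/-- The formal derivative `∂_y` of a formal Laurent series in `y` over `K`. -/
def derivLS (f : LaurentSeries K) : LaurentSeries K where
  coeff := fun n => ((n + 1 : ℤ) : K) * f.coeff (n + 1)
  isPWO_support' := by
    refine ((f.isPWO_support.add (Set.isPWO_singleton (-1 : ℤ))).mono ?_)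
    intro n hn
    simp only [Function.mem_support, ne_eq] at hn
    have hf : f.coeff (n + 1) ≠ 0 := fun h => hn (by simp [h])
    rw [Set.add_singleton]
    exact ⟨n + 1, by simpa [HahnSeries.mem_support] using hf, by ring⟩

/-- Multiplication of a formal Laurent series by `y^k`. -/
def ySh (k : ℤ) (f : LaurentSeries K) : LaurentSeries K :=
  (HahnSeries.single k (1 : K)) * f

/-- The operator `S_y f = u⁻² y³ ∂_y f + (1/2) u⁻² y² f + y⁻¹ f`. -/
def Sy (f : LaurentSeries K) : LaurentSeries K :=
  (u⁻¹ ^ 2) • ySh 3 (derivLS f) + ((1 / 2 : K) * u⁻¹ ^ 2) • ySh 2 f + ySh (-1) f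

/-- `a_n = (-1)^n (6n)! / (288^n (2n)! (3n)!)`. -/
def aQ (n : ℕ) : ℚ :=
  (-1) ^ n * ((6 * n).factorial : ℚ) /
    (288 ^ n * ((2 * n).factorial : ℚ) * ((3 * n).factorial : ℚ))

/-- The power-series-in-`y` `Σ_{n ≥ 0} c_n u^{-2n} y^{3n}` (viewed as a Laurent series)
attached to rational coefficients `c : ℕ → ℚ`. -/
def mkS (c : ℕ → ℚ) : LaurentSeries K :=
  HahnSeries.ofPowerSeries ℤ K
    (PowerSeries.mk fun m => if 3 ∣ m then ((c (m / 3) : ℚ) : K) * u⁻¹ ^ (2 * (m / 3)) else 0)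

/-- The series `A = Σ_{n ≥ 0} a_n u^{-2n} y^{3n}`. -/
def A : LaurentSeries K := mkS aQ

/-- `d_n = Σ_{i=0}^n 3^i |a_{n-i}| ∏_{k=1}^i (n + 1/2 - k)`. -/
def dQ (n : ℕ) : ℚ :=
  ∑ i ∈ Finset.range (n + 1),
    3 ^ i * |aQ (n - i)| * ∏ k ∈ Finset.Icc 1 i, ((n : ℚ) + 1 / 2 - (k : ℚ))

/-- The series `D = Σ_{m≥0} d_m u^{-2m} y^{3m}`. -/
def D : LaurentSeries K := mkS dQ

open HahnSeries

section CoeffMul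

variable {R : Type*} [CommRing R]

/-- Multiply the coefficients of a Laurent series by the values of a function. -/
def coeffScale (φ : ℤ → R) (f : LaurentSeries R) : LaurentSeries R where
  coeff n := φ n * f.coeff n
  isPWO_support' := f.isPWO_support.mono fun n hn h => hn (by simp [h])

@[simp]
lemma coeff_coeffScale (φ : ℤ → R) (f : LaurentSeries R) (n : ℤ) :
    (coeffScale φ f).coeff n = φ n * f.coeff n := rfl

lemma support_coeffScale_subset (φ : ℤ → R) (f : LaurentSeries R) :
    (coeffScale φ f).support ⊆ f.support := fun n hn h => hn (by simp [h])

lemma coeffScale_add (φ : ℤ → R) (f g : LaurentSeries R) :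
    coeffScale φ (f + g) = coeffScale φ f + coeffScale φ g := by
  ext n
  simp [mul_add]

/-- The Euler operator `y ∂_y`. -/
def euler (f : LaurentSeries R) : LaurentSeries R := coeffScale (fun n => (n : R)) f

/-- The substitution `y ↦ -y`. -/
def reflect (f : LaurentSeries R) : LaurentSeries R :=
  coeffScale (fun n => ((Int.negOnePow n : ℤ) : R)) f

lemma coeff_euler (f : LaurentSeries R) (n : ℤ) : (euler f).coeff n = n * f.coeff n := rfl

lemma coeff_reflect (f : LaurentSeries R) (n : ℤ) :
    (reflect f).coeff n = ((Int.negOnePow n : ℤ) : R) * f.coeff n := rfl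

lemma euler_add (f g : LaurentSeries R) : euler (f + g) = euler f + euler g :=
  coeffScale_add _ f g

lemma reflect_add (f g : LaurentSeries R) : reflect (f + g) = reflect f + reflect g :=
  coeffScale_add _ f g

lemma euler_mul (f g : LaurentSeries R) : euler (f * g) = euler f * g + f * euler g := by
  ext n
  rw [coeff_add, coeff_euler, coeff_mul, euler, euler,
    coeff_mul_left' f.isPWO_support (support_coeffScale_subset _ f),
    coeff_mul_right' g.isPWO_support (support_coeffScale_subset _ g), Finset.mul_sum,
    ← Finset.sum_add_distrib]
  refine Finset.sum_congr rfl fun ij hij => ?_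
  rw [← (Finset.mem_antidiagonal.mp hij).2.2, coeff_coeffScale, coeff_coeffScale]
  push_cast
  ring

lemma negOnePow_mul_self (n : ℤ) :
    ((Int.negOnePow n : ℤ) : R) * ((Int.negOnePow n : ℤ) : R) = 1 := by
  rw [← Int.cast_mul, ← Units.val_mul, Int.units_mul_self]
  simp

lemma reflect_reflect (f : LaurentSeries R) : reflect (reflect f) = f := by
  ext n
  rw [coeff_reflect, coeff_reflect, ← mul_assoc, negOnePow_mul_self, one_mul]

lemma support_reflect (f : LaurentSeries R) : (reflect f).support = f.support := by
  refine (support_coeffScale_subset _ f).antisymm ?_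
  conv_lhs => rw [← reflect_reflect f]
  exact support_coeffScale_subset _ _

lemma reflect_mul (f g : LaurentSeries R) : reflect (f * g) = reflect f * reflect g := by
  ext n
  rw [coeff_reflect, coeff_mul, coeff_mul, Finset.mul_sum]
  refine Finset.sum_congr (by ext; simp [Finset.mem_antidiagonal, support_reflect])
    fun ij hij => ?_
  rw [← (Finset.mem_antidiagonal.mp hij).2.2, coeff_reflect, coeff_reflect, Int.negOnePow_add]
  push_cast
  ring

lemma reflect_euler (f : LaurentSeries R) : reflect (euler f) = euler (reflect f) := by
  ext n
  simp only [coeff_reflect, coeff_euler]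
  ring

lemma euler_C (r : R) : euler (C r : LaurentSeries R) = 0 := by
  ext n
  by_cases h : n = 0 <;> simp [coeff_euler, C_apply, coeff_single_of_ne, h]

lemma reflect_C (r : R) : reflect (C r : LaurentSeries R) = C r := by
  ext n
  by_cases h : n = 0 <;> simp [coeff_reflect, C_apply, coeff_single_of_ne, h]

end CoeffMul

section Operator

/-- The variable `y`. -/
def yVar : LaurentSeries K := single 1 1

/-- The inverse of the variable `y`. -/
def yInv : LaurentSeries K := single (-1) 1

/-- The constant `u⁻²`. -/
def uInvSq : LaurentSeries K := C (u⁻¹ ^ 2)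

/-- The constant `1 / 2`. -/
def halfLS : LaurentSeries K := C (1 / 2)

lemma yVar_mul_yInv : yVar * yInv = 1 := by
  simp [yVar, yInv, single_mul_single]

lemma two_mul_halfLS : 2 * halfLS = 1 := by
  rw [halfLS, ← map_ofNat C 2, ← map_mul]
  simp

lemma u_ne_zero : u ≠ 0 := RatFunc.X_ne_zero

lemma uInvSq_mul_yVar_sq_ne_zero : uInvSq * yVar ^ 2 ≠ 0 := by
  have h : uInvSq ≠ 0 := by
    rw [uInvSq]
    exact C_ne_zero (pow_ne_zero 2 (inv_ne_zero u_ne_zero))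
  exact mul_ne_zero h (pow_ne_zero 2 (left_ne_zero_of_mul_eq_one yVar_mul_yInv))

lemma euler_yVar : euler yVar = yVar := by
  ext n
  by_cases h : n = 1 <;> simp [coeff_euler, yVar, coeff_single_of_ne, h]

lemma euler_yInv : euler yInv = -yInv := by
  ext n
  by_cases h : n = -1 <;> simp [coeff_euler, yInv, coeff_single_of_ne, h]

lemma reflect_yVar : reflect yVar = -yVar := by
  ext n
  by_cases h : n = 1 <;> simp [coeff_reflect, yVar, coeff_single_of_ne, h]

lemma reflect_yInv : reflect yInv = -yInv := by
  ext n
  by_cases h : n = -1 <;> simp [coeff_reflect, yInv, coeff_single_of_ne, h]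

lemma coeff_yInv_mul (f : LaurentSeries K) (n : ℤ) : (yInv * f).coeff n = f.coeff (n + 1) := by
  rw [yInv, coeff_single_mul, one_mul, sub_neg_eq_add]

lemma coeff_C_mul (r : K) (f : LaurentSeries K) (n : ℤ) : (C r * f).coeff n = r * f.coeff n := by
  rw [C_mul_eq_smul, coeff_smul, smul_eq_mul]

lemma Sy_eq (f : LaurentSeries K) :
    Sy f = uInvSq * yVar ^ 2 * euler f + halfLS * uInvSq * yVar ^ 2 * f + yInv * f := by
  have hy : (single 2 1 : LaurentSeries K) = yVar ^ 2 := by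
    simp [yVar, sq, single_mul_single]
  have hd : ySh 3 (derivLS f) = yVar ^ 2 * euler f := by
    ext n
    rw [ySh, ← hy, coeff_single_mul, coeff_single_mul, coeff_euler]
    simp only [derivLS]
    rw [show n - 3 + 1 = n - 2 by ring]
  rw [Sy, hd, ySh, ySh, hy, ← C_mul_eq_smul, ← C_mul_eq_smul, map_mul, uInvSq, halfLS, yInv]
  ring

lemma Sy_add (f g : LaurentSeries K) : Sy (f + g) = Sy f + Sy g := by
  simp only [Sy_eq, euler_add]
  ring

lemma Sy_C_mul (r : K) (f : LaurentSeries K) : Sy (C r * f) = C r * Sy f := by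
  simp only [Sy_eq, euler_mul, euler_C]
  ring

lemma euler_uInvSq : euler uInvSq = 0 := euler_C _

lemma euler_halfLS : euler halfLS = 0 := euler_C _

lemma Sy_Sy (f : LaurentSeries K) :
    Sy (Sy f) = uInvSq ^ 2 * yVar ^ 4 * (euler (euler f) + 3 * euler f + 5 * halfLS ^ 2 * f)
      + 2 * uInvSq * yVar * euler f + yInv ^ 2 * f := by
  simp only [Sy_eq, euler_add, euler_mul, sq, euler_uInvSq, euler_halfLS, euler_yVar, euler_yInv]
  linear_combination (uInvSq ^ 2 * yVar ^ 4 * euler f - 2 * halfLS * uInvSq ^ 2 * yVar ^ 4 * f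
    + uInvSq * yVar ^ 2 * yInv * f) * two_mul_halfLS
    + 2 * uInvSq * yVar * euler f * yVar_mul_yInv

lemma Sy_yInv_sq_mul (f : LaurentSeries K) :
    Sy (yInv ^ 2 * f) = yInv ^ 2 * Sy f + C (-2 * u⁻¹ ^ 2) * f := by
  have hC : (C (-2 * u⁻¹ ^ 2) : LaurentSeries K) = -2 * uInvSq := by
    rw [map_mul, uInvSq, map_neg, map_ofNat]
  rw [hC]
  simp only [Sy_eq, euler_mul, sq, euler_yInv]
  linear_combination (-2 * uInvSq * f * (yVar * yInv + 1)) * yVar_mul_yInv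

lemma iterate_Sy_yInv_sq_mul (f : LaurentSeries K) (m : ℕ) :
    Sy^[m + 1] (yInv ^ 2 * f) =
      yInv ^ 2 * Sy^[m + 1] f + C (-2 * (m + 1) * u⁻¹ ^ 2) * Sy^[m] f := by
  induction m with
  | zero => simpa using Sy_yInv_sq_mul f
  | succ m ih =>
    rw [Function.iterate_succ_apply', ih, Sy_add, Sy_C_mul, Sy_yInv_sq_mul,
      ← Function.iterate_succ_apply' Sy, ← Function.iterate_succ_apply' Sy, add_assoc, ← add_mul,
      ← map_add]
    congr 3
    push_cast
    ring

lemma reflect_Sy (f : LaurentSeries K) :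
    reflect (Sy f) = uInvSq * yVar ^ 2 * euler (reflect f)
      + halfLS * uInvSq * yVar ^ 2 * reflect f - yInv * reflect f := by
  have hu : reflect uInvSq = uInvSq := reflect_C _
  have hh : reflect halfLS = halfLS := reflect_C _
  simp only [Sy_eq, reflect_add, reflect_mul, sq, hu, hh, reflect_yVar, reflect_yInv,
    reflect_euler]
  ring

lemma mul_Sy (g f : LaurentSeries K) :
    g * Sy f = yInv * ((g - uInvSq * yVar ^ 3 * (euler g + 3 * halfLS * g)) * f)
      + uInvSq * euler (yVar ^ 2 * g * f) := by
  simp only [Sy_eq, euler_mul, sq, euler_yVar]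
  linear_combination (uInvSq * yVar ^ 2 * g * f * 2) * two_mul_halfLS
    + (uInvSq * yVar ^ 2 * (euler g + 3 * halfLS * g) * f) * yVar_mul_yInv

/-- Constancy of the Wronskian of a solution of `S_y² f = y⁻² f` and its reflection. -/
lemma euler_wronskian {f : LaurentSeries K} (hf : Sy (Sy f) = yInv ^ 2 * f) :
    euler (reflect f * Sy f - f * reflect (Sy f)) =
      -(reflect f * Sy f - f * reflect (Sy f)) := by
  apply mul_left_cancel₀ uInvSq_mul_yVar_sq_ne_zero
  have h₁ := Sy_eq f
  have h₂ := reflect_Sy f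
  have h₃ := (Sy_eq (Sy f)).symm.trans hf
  have h₄ := congrArg reflect hf
  rw [reflect_Sy, sq yInv, reflect_mul, reflect_mul, reflect_yInv] at h₄
  have hsub : euler (reflect f * Sy f - f * reflect (Sy f)) =
      euler (reflect f) * Sy f + reflect f * euler (Sy f)
        - (euler f * reflect (Sy f) + f * euler (reflect (Sy f))) := by
    rw [eq_sub_iff_add_eq, ← euler_mul, ← euler_mul, ← euler_add, sub_add_cancel]
  rw [hsub]
  linear_combination reflect (Sy f) * h₁ - Sy f * h₂ + reflect f * h₃ - f * h₄
    - (uInvSq * yVar ^ 2 * (reflect f * Sy f - f * reflect (Sy f))) * two_mul_halfLS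

lemma coeff_reflect_mul_self_of_odd (f : LaurentSeries K) {n : ℤ} (hn : Odd n) :
    (reflect f * f).coeff n = 0 := by
  have h : reflect (reflect f * f) = reflect f * f := by
    rw [reflect_mul, reflect_reflect, mul_comm]
  have h' := congrArg (fun g => g.coeff n) h
  simp only [coeff_reflect, Int.negOnePow_odd n hn] at h'
  push_cast at h'
  have h2 : (2 : K) * (reflect f * f).coeff n = 0 := by linear_combination -h'
  simpa using h2

lemma coeff_reflect_mul_Sy_of_odd {f : LaurentSeries K} (hf : Sy (Sy f) = yInv ^ 2 * f)
    {n : ℤ} (hn : Odd n) (hn' : n ≠ -1) : (reflect f * Sy f).coeff n = 0 := by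
  have h := congrArg (fun g => g.coeff n) (euler_wronskian hf)
  have hr : f * reflect (Sy f) = reflect (reflect f * Sy f) := by
    rw [reflect_mul, reflect_reflect]
  simp only [hr, coeff_euler, coeff_neg, coeff_sub, coeff_reflect, Int.negOnePow_odd n hn] at h
  push_cast at h
  have h2 : (((n + 1 : ℤ) : K) * 2) * (reflect f * Sy f).coeff n = 0 := by
    push_cast
    linear_combination h
  refine (mul_eq_zero.mp h2).resolve_left (mul_ne_zero ?_ two_ne_zero)
  exact Int.cast_ne_zero.mpr (by omega)

lemma coeff_reflect_mul_iterate_Sy {f : LaurentSeries K} (hf : Sy (Sy f) = yInv ^ 2 * f) :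
    ∀ (m j : ℕ), (reflect f * Sy^[m] f).coeff (2 * j + 1) = 0
  | 0, j => coeff_reflect_mul_self_of_odd f ⟨j, rfl⟩
  | 1, j => coeff_reflect_mul_Sy_of_odd hf ⟨j, rfl⟩ (by omega)
  | 2, j => by
    rw [Function.iterate_succ_apply, Function.iterate_one, hf,
      show reflect f * (yInv ^ 2 * f) = yInv * (yInv * (reflect f * f)) by ring,
      coeff_yInv_mul, coeff_yInv_mul]
    exact coeff_reflect_mul_self_of_odd f ⟨j + 1, by ring⟩
  | m + 3, j => by
    rw [show m + 3 = (m + 1) + 1 + 1 from rfl, Function.iterate_succ_apply,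
      Function.iterate_succ_apply, hf, iterate_Sy_yInv_sq_mul, mul_add,
      show ∀ g : LaurentSeries K, reflect f * (yInv ^ 2 * g) =
        yInv * (yInv * (reflect f * g)) from fun g => by ring,
      mul_left_comm _ (C _), coeff_add, coeff_yInv_mul, coeff_yInv_mul, coeff_C_mul,
      coeff_reflect_mul_iterate_Sy hf m j, mul_zero, add_zero]
    have h := coeff_reflect_mul_iterate_Sy hf (m + 1) (j + 1)
    rw [← h]
    congr 1

end Operator

section Series

lemma coeff_mkS_three_mul (c : ℕ → ℚ) (n : ℕ) :
    (mkS c).coeff (3 * n : ℤ) = (c n : K) * u⁻¹ ^ (2 * n) := by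
  have h : (3 * n : ℤ) = ((3 * n : ℕ) : ℤ) := by push_cast; rfl
  rw [mkS, h, ofPowerSeries_apply_coeff, PowerSeries.coeff_mk, if_pos (dvd_mul_right 3 n),
    Nat.mul_div_cancel_left n (by norm_num)]

lemma coeff_mkS_eq_zero (c : ℕ → ℚ) {k : ℤ} (hk : ∀ n : ℕ, k ≠ 3 * n) :
    (mkS c).coeff k = 0 := by
  rw [mkS, PowerSeries.coeff_coe]
  split_ifs with h
  · rfl
  · rw [PowerSeries.coeff_mk, if_neg]
    rintro ⟨n, hn⟩
    exact hk n (by omega)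

lemma mkS_add (c d : ℕ → ℚ) : mkS c + mkS d = mkS fun n => c n + d n := by
  ext k
  by_cases hk : ∃ n : ℕ, k = 3 * n
  · obtain ⟨n, rfl⟩ := hk
    simp only [coeff_add, coeff_mkS_three_mul]
    push_cast
    ring
  · push Not at hk
    simp [coeff_mkS_eq_zero _ hk]

lemma C_mul_mkS (q : ℚ) (c : ℕ → ℚ) : C (q : K) * mkS c = mkS fun n => q * c n := by
  ext k
  rw [coeff_C_mul]
  by_cases hk : ∃ n : ℕ, k = 3 * n
  · obtain ⟨n, rfl⟩ := hk
    simp only [coeff_mkS_three_mul]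
    push_cast
    ring
  · push Not at hk
    simp [coeff_mkS_eq_zero _ hk]

lemma euler_mkS (c : ℕ → ℚ) : euler (mkS c) = mkS fun n => 3 * n * c n := by
  ext k
  rw [coeff_euler]
  by_cases hk : ∃ n : ℕ, k = 3 * n
  · obtain ⟨n, rfl⟩ := hk
    simp only [coeff_mkS_three_mul]
    push_cast
    ring
  · push Not at hk
    simp [coeff_mkS_eq_zero _ hk]

lemma reflect_mkS (c : ℕ → ℚ) : reflect (mkS c) = mkS fun n => (-1) ^ n * c n := by
  ext k
  rw [coeff_reflect]
  by_cases hk : ∃ n : ℕ, k = 3 * n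
  · obtain ⟨n, rfl⟩ := hk
    have h : ((3 * n : ℤ).negOnePow : ℤ) = (-1) ^ n := by
      rcases n.even_or_odd with hn | hn
      · rw [hn.neg_one_pow, Int.negOnePow_even _ (((Int.even_coe_nat n).mpr hn).mul_left 3)]
        rfl
      · rw [hn.neg_one_pow, Int.negOnePow_odd _ (Odd.mul (by decide) (by exact_mod_cast hn))]
        rfl
    simp only [coeff_mkS_three_mul, h]
    push_cast
    ring
  · push Not at hk
    simp [coeff_mkS_eq_zero _ hk]

lemma uInvSq_mul_yVar_cube_mul_mkS (c : ℕ → ℚ) :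
    uInvSq * yVar ^ 3 * mkS c = mkS fun n => if n = 0 then 0 else c (n - 1) := by
  have hy : yVar ^ 3 = single 3 1 := by
    simp [yVar, pow_succ, single_mul_single]
  ext k
  rw [hy, mul_assoc, uInvSq, coeff_C_mul, coeff_single_mul, one_mul]
  by_cases hk : ∃ n : ℕ, k = 3 * n
  · obtain ⟨n, rfl⟩ := hk
    rcases n with _ | n
    · rw [coeff_mkS_three_mul, coeff_mkS_eq_zero _ (fun n => by omega)]
      simp
    · rw [coeff_mkS_three_mul, show (3 * ((n + 1 : ℕ) : ℤ) - 3) = 3 * (n : ℤ) by push_cast; ring,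
        coeff_mkS_three_mul]
      simp only [Nat.add_eq_zero_iff, one_ne_zero, and_false, if_false, Nat.add_sub_cancel]
      ring
  · push Not at hk
    rw [coeff_mkS_eq_zero _ hk, coeff_mkS_eq_zero _, mul_zero]
    intro n hn
    exact hk (n + 1) (by push_cast; omega)

lemma aQ_succ (n : ℕ) :
    (3 * n + 1 / 2) * (3 * n + 5 / 2) * aQ n + 6 * (n + 1) * aQ (n + 1) = 0 := by
  have h6 : 6 * (n + 1) = 6 * n + 1 + 1 + 1 + 1 + 1 + 1 := by ring
  have h2 : 2 * (n + 1) = 2 * n + 1 + 1 := by ring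
  have h3 : 3 * (n + 1) = 3 * n + 1 + 1 + 1 := by ring
  simp only [aQ, h6, h2, h3, Nat.factorial_succ]
  have e2 : ((2 * n).factorial : ℚ) ≠ 0 := by positivity
  have e3 : ((3 * n).factorial : ℚ) ≠ 0 := by positivity
  push_cast
  field_simp
  ring

lemma abs_aQ (n : ℕ) : |aQ n| = (-1) ^ n * aQ n := by
  rw [aQ, abs_div, abs_mul, abs_pow, abs_neg, abs_one, one_pow, one_mul,
    abs_of_nonneg (by positivity), abs_of_nonneg (by positivity), ← mul_div_assoc, ← mul_assoc,
    ← mul_pow]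
  simp

lemma Sy_Sy_A : Sy (Sy A) = yInv ^ 2 * A := by
  have h : uInvSq * yVar ^ 3 * (euler (euler A) + 3 * euler A + 5 * halfLS ^ 2 * A)
      + 2 * euler A = 0 := by
    have h2 : (2 : LaurentSeries K) = C ((2 : ℚ) : K) := by rw [Rat.cast_ofNat, map_ofNat]
    have h3 : (3 : LaurentSeries K) = C ((3 : ℚ) : K) := by rw [Rat.cast_ofNat, map_ofNat]
    have h5 : 5 * halfLS ^ 2 = C ((5 / 4 : ℚ) : K) := by
      rw [halfLS, ← map_ofNat C 5, ← map_pow, ← map_mul]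
      congr 1
      push_cast
      norm_num
    rw [h2, h5, h3, A]
    simp only [euler_mkS, C_mul_mkS, mkS_add, uInvSq_mul_yVar_cube_mul_mkS]
    rw [show (0 : LaurentSeries K) = C ((0 : ℚ) : K) * mkS aQ by simp, C_mul_mkS]
    congr 1
    funext n
    rcases n with _ | n
    · simp
    · simp only [Nat.add_eq_zero_iff, one_ne_zero, and_false, if_false, Nat.add_sub_cancel]
      push_cast
      linear_combination aQ_succ n
  rw [Sy_Sy]
  linear_combination uInvSq * yVar * h

lemma dQ_zero : dQ 0 = |aQ 0| := by
  simp [dQ]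

lemma dQ_succ (n : ℕ) : dQ (n + 1) = |aQ (n + 1)| + (3 * n + 3 / 2) * dQ n := by
  have hp (f : ℕ → ℚ) (i : ℕ) : ∏ k ∈ Finset.Icc 1 i, f k = ∏ k ∈ Finset.range i, f (k + 1) := by
    rw [Finset.range_eq_Ico, Finset.prod_Ico_add' f 0 i 1]
    rfl
  rw [dQ, Finset.sum_range_succ', dQ, Finset.mul_sum, add_comm]
  congr 1
  · simp
  · refine Finset.sum_congr rfl fun i _ => ?_
    rw [hp, hp, Finset.prod_range_succ', Nat.add_sub_add_right]
    have h : ∀ k : ℕ, ((n + 1 : ℕ) : ℚ) + 1 / 2 - ((k + 1 + 1 : ℕ) : ℚ)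
        = (n : ℚ) + 1 / 2 - ((k + 1 : ℕ) : ℚ) := fun k => by push_cast; ring
    simp only [h]
    push_cast
    ring

lemma D_sub_eq_reflect_A :
    D - uInvSq * yVar ^ 3 * (euler D + 3 * halfLS * D) = reflect A := by
  have h3 : 3 * halfLS = C ((3 / 2 : ℚ) : K) := by
    rw [halfLS, ← map_ofNat C 3, ← map_mul]
    congr 1
    push_cast
    norm_num
  rw [sub_eq_iff_eq_add, h3, D, A]
  simp only [euler_mkS, C_mul_mkS, mkS_add, uInvSq_mul_yVar_cube_mul_mkS, reflect_mkS, ← abs_aQ]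
  congr 1
  funext n
  rcases n with _ | n
  · simp [dQ_zero]
  · simp only [dQ_succ, Nat.add_eq_zero_iff, one_ne_zero, and_false, if_false, Nat.add_sub_cancel]
    ring

end Series

/-- For every `n ≥ 1`, the coefficient of `y^0` in `D · (S_y^n A)` vanishes. -/
theorem stmt11 (n : ℕ) (hn : 1 ≤ n) :
    (D * Sy^[n] A).coeff 0 = 0 := by
  obtain ⟨m, rfl⟩ : ∃ m, n = m + 1 := ⟨n - 1, by omega⟩
  rw [Function.iterate_succ_apply', mul_Sy, D_sub_eq_reflect_A, coeff_add, coeff_yInv_mul,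
    uInvSq, coeff_C_mul, coeff_euler, Int.cast_zero, zero_mul, mul_zero, add_zero]
  simpa using coeff_reflect_mul_iterate_Sy Sy_Sy_A m 0

end
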